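/- In the partition algebra A_k(z) (k ≥ 2): for every i with 1 ≤ i ≤ k−1 one has σ_{i+1/2} s_i = s_i σ_{i+1/2} = σ_{i+1}. -/

import Mathlib

open Polynomial

/-- Elements of an algebra over `R = ℤ[z]` (with `z = Polynomial.X`) satisfying the
defining relations of the partition algebra `A_k(z)` of Halverson–Ram.
Here `p i` stands for the generator `p_i` (for `1 ≤ i ≤ k`), `q i` stands for the
half-integer generator `p_{i+1/2}` (for `1 ≤ i ≤ k-1`), and `s i` stands for `s_i`
(for `1 ≤ i ≤ k-1`). -/
structure PartitionAlgebra (k : ℕ) (A : Type*) [Ring A] [Algebra (Polynomial ℤ) A] where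
  p : ℕ → A
  q : ℕ → A
  s : ℕ → A
  s_sq : ∀ i, 1 ≤ i → i ≤ k - 1 → s i * s i = 1
  s_comm : ∀ i j, 1 ≤ i → i ≤ k - 1 → 1 ≤ j → j ≤ k - 1 → j ≠ i + 1 → i ≠ j + 1 →
    s i * s j = s j * s i
  braid : ∀ i, 1 ≤ i → i + 1 ≤ k - 1 →
    s i * s (i + 1) * s i = s (i + 1) * s i * s (i + 1)
  p_sq : ∀ i, 1 ≤ i → i ≤ k → p i * p i = (X : Polynomial ℤ) • p i
  q_sq : ∀ i, 1 ≤ i → i ≤ k - 1 → q i * q i = q i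
  s_q : ∀ i, 1 ≤ i → i ≤ k - 1 → s i * q i = q i
  q_s : ∀ i, 1 ≤ i → i ≤ k - 1 → q i * s i = q i
  s_pp : ∀ i, 1 ≤ i → i ≤ k - 1 → s i * (p i * p (i + 1)) = p i * p (i + 1)
  pp_s : ∀ i, 1 ≤ i → i ≤ k - 1 → p i * p (i + 1) * s i = p i * p (i + 1)
  p_comm : ∀ i j, 1 ≤ i → i ≤ k → 1 ≤ j → j ≤ k → p i * p j = p j * p i
  q_comm : ∀ i j, 1 ≤ i → i ≤ k - 1 → 1 ≤ j → j ≤ k - 1 → q i * q j = q j * q i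
  q_p : ∀ i j, 1 ≤ i → i ≤ k - 1 → 1 ≤ j → j ≤ k → j ≠ i → j ≠ i + 1 →
    q i * p j = p j * q i
  s_p : ∀ i j, 1 ≤ i → i ≤ k - 1 → 1 ≤ j → j ≤ k → j ≠ i → j ≠ i + 1 →
    s i * p j = p j * s i
  s_q' : ∀ i j, 1 ≤ i → i ≤ k - 1 → 1 ≤ j → j ≤ k - 1 → j + 1 ≠ i → j ≠ i + 1 →
    s i * q j = q j * s i
  sps : ∀ i, 1 ≤ i → i ≤ k - 1 → s i * p i * s i = p (i + 1)
  sqs : ∀ i, 2 ≤ i → i ≤ k - 1 →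
    s i * q (i - 1) * s i = s (i - 1) * q i * s (i - 1)
  qpq₁ : ∀ i, 1 ≤ i → i ≤ k - 1 → q i * p i * q i = q i
  qpq₂ : ∀ i, 1 ≤ i → i ≤ k - 1 → q i * p (i + 1) * q i = q i
  pqp₁ : ∀ i, 2 ≤ i → i ≤ k → p i * q (i - 1) * p i = p i
  pqp₂ : ∀ i, 1 ≤ i → i ≤ k - 1 → p i * q i * p i = p i

namespace PartitionAlgebra

variable {k : ℕ} {A : Type*} [Ring A] [Algebra (Polynomial ℤ) A]

/-- `(P.LS i).1 = L_i` and `(P.LS i).2 = σ_i` (with the junk value `σ_0 := 1`). -/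
def LS (P : PartitionAlgebra k A) : ℕ → A × A
  | 0 => (0, 1)
  | 1 => (P.p 1, 1)
  | n + 2 =>
    let Lp := (P.LS (n + 1)).1
    let sp := (P.LS (n + 1)).2
    let Lpp := (P.LS n).1
    let snew : A :=
      if n = 0 then P.s 1
      else
        P.s n * P.s (n + 1) * sp * P.s (n + 1) * P.s n
          + P.s (n + 1) * P.q n * Lpp * P.s (n + 1) * P.q n * P.s (n + 1)
          + P.q n * Lpp * P.s (n + 1) * P.q n
          - P.s (n + 1) * P.q n * Lpp * P.s n * P.q (n + 1) * P.p (n + 1) * P.q n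
          - P.q n * P.p (n + 1) * P.q (n + 1) * P.s n * Lpp * P.q n * P.s (n + 1)
    (-(P.s (n + 1) * Lp * P.q (n + 1)) - P.q (n + 1) * Lp * P.s (n + 1)
        + P.q (n + 1) * Lp * P.p (n + 2) * P.q (n + 1)
        + P.s (n + 1) * Lp * P.s (n + 1) + snew,
      snew)

/-- The Jucys–Murphy element `L_i` of the partition algebra. -/
def L (P : PartitionAlgebra k A) (i : ℕ) : A := (P.LS i).1

/-- The element `σ_i` of the partition algebra. -/
def sig (P : PartitionAlgebra k A) (i : ℕ) : A := (P.LS i).2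

/-- `(P.LSh i).1 = L_{i+1/2}` and `(P.LSh i).2 = σ_{i+1/2}`. -/
def LSh (P : PartitionAlgebra k A) : ℕ → A × A
  | 0 => (0, 1)
  | 1 =>
    (-(P.L 1 * P.q 1) - P.q 1 * P.L 1 + P.q 1 * P.L 1 * P.p 1 * P.q 1
        + P.s 1 * (0 : A) * P.s 1 + 1, 1)
  | n + 2 =>
    let Lhp := (P.LSh (n + 1)).1
    let shp := (P.LSh (n + 1)).2
    let snew : A :=
      P.s (n + 1) * P.s (n + 2) * shp * P.s (n + 2) * P.s (n + 1)
        + P.q (n + 1) * P.L (n + 1) * P.s (n + 2) * P.q (n + 1) * P.s (n + 2)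
        + P.s (n + 2) * P.q (n + 1) * P.L (n + 1) * P.s (n + 2) * P.q (n + 1)
        - P.q (n + 1) * P.L (n + 1) * P.s (n + 1) * P.q (n + 2) * P.p (n + 2) * P.q (n + 1)
        - P.s (n + 2) * P.q (n + 1) * P.p (n + 2) * P.q (n + 2) * P.s (n + 1)
            * P.L (n + 1) * P.q (n + 1) * P.s (n + 2)
    (-(P.L (n + 2) * P.q (n + 2)) - P.q (n + 2) * P.L (n + 2)
        + P.q (n + 2) * P.L (n + 2) * P.p (n + 2) * P.q (n + 2)
        + P.s (n + 2) * Lhp * P.s (n + 2) + snew,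
      snew)

/-- The half-integer Jucys–Murphy element `L_{i+1/2}` of the partition algebra. -/
def Lh (P : PartitionAlgebra k A) (i : ℕ) : A := (P.LSh i).1

/-- The element `σ_{i+1/2}` of the partition algebra. -/
def sigH (P : PartitionAlgebra k A) (i : ℕ) : A := (P.LSh i).2

end PartitionAlgebra

/-- Relations between the generators `a = s_n`, `b = s_{n+1}`, `q = p_{n+1/2}`, `r = p_{n+3/2}`,
`p = p_n`, `p' = p_{n+1}`, `p'' = p_{n+2}` and the elements `T = σ_{n+1/2}`, `L = L_n` of a
partition algebra. They are stable under passing to the opposite monoid. -/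
structure LocalRel {M : Type*} [Monoid M] (a b q r p p' p'' T L : M) : Prop where
  aa : a * a = 1
  bb : b * b = 1
  aq : a * q = q
  qa : q * a = q
  br : b * r = r
  rb : r * b = r
  apa : a * p * a = p'
  bpb : b * p' * b = p''
  bqb : b * q * b = a * r * a
  qr : q * r = r * q
  rpr : r * p' * r = r
  qpq : q * p' * q = q
  prp : p' * r * p' = p'
  pqp : p' * q * p' = p'
  bp : b * p = p * b
  qp : q * p'' = p'' * q
  Ta : T * a = a * T
  Tr : T * r = r * T
  Tp : T * p'' = p'' * T
  Lb : L * b = b * L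
  Lp : L * p' = p' * L
  qL : q * L = q * p * T
  Lq : L * q = T * p * q

namespace LocalRel

section Monoid

variable {M : Type*} [Monoid M] {a b q r p p' p'' T L : M}

open MulOpposite in
theorem op (h : LocalRel a b q r p p' p'' T L) :
    LocalRel (op a) (op b) (op q) (op r) (op p) (op p') (op p'') (op T) (op L) := by
  constructor <;> simp only [← op_mul, ← mul_assoc, h.aa, h.bb, h.aq, h.qa, h.br, h.rb, h.apa,
    h.bpb, h.bqb, h.qr, h.rpr, h.qpq, h.prp, h.pqp, h.bp, h.qp, h.Ta, h.Tr, h.Tp, h.Lb, h.Lp,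
    h.qL, h.Lq, op_one]

theorem ap (h : LocalRel a b q r p p' p'' T L) : a * p' = p * a := by
  rw [← h.apa, ← mul_assoc, ← mul_assoc, h.aa, one_mul]

theorem bp' (h : LocalRel a b q r p p' p'' T L) : b * p'' = p' * b := by
  rw [← h.bpb, ← mul_assoc, ← mul_assoc, h.bb, one_mul]

theorem pb (h : LocalRel a b q r p p' p'' T L) : b * p' = p'' * b := by
  rw [← h.bpb, mul_assoc, h.bb, mul_one]

theorem ar (h : LocalRel a b q r p p' p'' T L) : a * r = b * q * b * a := by
  rw [h.bqb, mul_assoc, h.aa, mul_one]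

theorem qpa (h : LocalRel a b q r p p' p'' T L) : q * p * a = q * p' := by
  rw [← h.apa, ← mul_assoc, ← mul_assoc, h.qa]

theorem apq (h : LocalRel a b q r p p' p'' T L) : a * p * q = p' * q := by
  rw [← h.apa, mul_assoc _ a q, h.aq]

theorem T_bqb (h : LocalRel a b q r p p' p'' T L) : T * (b * q * b) = b * q * b * T := by
  rw [h.bqb, ← mul_assoc, ← mul_assoc, h.Ta, mul_assoc a T, h.Tr, ← mul_assoc, mul_assoc _ T,
    h.Ta, ← mul_assoc]

theorem bqb_p (h : LocalRel a b q r p p' p'' T L) : b * q * b * p' = p' * (b * q * b) := by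
  rw [mul_assoc, h.pb, ← mul_assoc, mul_assoc b, h.qp, ← mul_assoc, h.bp']
  simp only [mul_assoc]

theorem bqb_r (h : LocalRel a b q r p p' p'' T L) : b * q * b * r = q * r := by
  rw [mul_assoc, h.br, mul_assoc, h.qr, ← mul_assoc, h.br]

theorem bqb_pr (h : LocalRel a b q r p p' p'' T L) : b * q * b * p' * r = p' * q * r := by
  rw [h.bqb_p, mul_assoc, h.bqb_r, mul_assoc]

theorem rbTb (h : LocalRel a b q r p p' p'' T L) : r * b * T * b = r * T := by
  rw [h.rb, ← h.Tr, mul_assoc, h.rb]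

theorem q_comm (h : LocalRel a b q r p p' p'' T L) : q * (b * T * b) = b * T * b * q := by
  calc q * (b * T * b) = b * b * q * (b * T * b) := by rw [h.bb, one_mul]
    _ = b * (b * q * b * T) * b := by simp only [mul_assoc]
    _ = b * T * b * q * (b * b) := by rw [← h.T_bqb]; simp only [mul_assoc]
    _ = b * T * b * q := by rw [h.bb, mul_one]

theorem q_L_a_r (h : LocalRel a b q r p p' p'' T L) : q * L * a * r = q * p' * r * T := by
  calc q * L * a * r = q * p * (T * a) * r := by rw [h.qL]; simp only [mul_assoc]
    _ = q * p * a * (T * r) := by rw [h.Ta]; simp only [mul_assoc]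
    _ = q * p' * r * T := by rw [h.qpa, h.Tr]; simp only [mul_assoc]

theorem q_L_a_r_p_q (h : LocalRel a b q r p p' p'' T L) :
    q * L * a * r * p' * q = q * (b * T * b) := by
  calc q * L * a * r * p' * q = q * p' * (r * T) * p' * q := by
        rw [h.q_L_a_r]; simp only [mul_assoc]
    _ = q * p' * r * b * T * (b * p') * q := by rw [← h.rbTb]; simp only [mul_assoc]
    _ = q * p' * r * b * (T * p'') * b * q := by rw [h.pb]; simp only [mul_assoc]
    _ = q * p' * r * (b * p'') * T * b * q := by rw [h.Tp]; simp only [mul_assoc]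
    _ = q * (p' * r * p') * b * T * b * q := by rw [h.bp']; simp only [mul_assoc]
    _ = q * p' * (b * T * b * q) := by rw [h.prp]; simp only [mul_assoc]
    _ = q * p' * q * (b * T * b) := by rw [← h.q_comm]; simp only [mul_assoc]
    _ = q * (b * T * b) := by rw [h.qpq]

theorem q_p_r_a_L_q (h : LocalRel a b q r p p' p'' T L) :
    q * p' * r * a * L * q = q * (b * T * b) := by
  rw [h.q_comm]
  simpa only [← MulOpposite.op_mul, MulOpposite.op_inj, ← mul_assoc] using h.op.q_L_a_r_p_q

theorem a_L_q_r (h : LocalRel a b q r p p' p'' T L) :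
    a * L * q * r = b * q * b * T * p' * r := by
  calc a * L * q * r = a * (L * q) * r := by simp only [mul_assoc]
    _ = T * a * p * q * r := by rw [h.Lq, h.Ta]; simp only [mul_assoc]
    _ = T * (a * p * q) * r := by simp only [mul_assoc]
    _ = T * (b * q * b * p' * r) := by rw [h.apq, h.bqb_pr, mul_assoc]
    _ = T * (b * q * b) * p' * r := by simp only [mul_assoc]
    _ = b * q * b * T * p' * r := by rw [h.T_bqb]

theorem q_bTb_p_r (h : LocalRel a b q r p p' p'' T L) :
    q * (b * T * b) * p' * r = q * L * a * r := by
  calc q * (b * T * b) * p' * r = q * b * T * (b * p') * r := by simp only [mul_assoc]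
    _ = q * b * (T * p'') * (b * r) := by rw [h.pb]; simp only [mul_assoc]
    _ = q * (b * p'') * (T * r) := by rw [h.Tp, h.br]; simp only [mul_assoc]
    _ = q * p' * (b * r) * T := by rw [h.bp', h.Tr]; simp only [mul_assoc]
    _ = q * L * a * r := by rw [h.br, h.q_L_a_r]

theorem q_L_p_q_r (h : LocalRel a b q r p p' p'' T L) :
    q * L * p' * q * r = q * p * (T * (b * q * b)) * p' * r := by
  calc q * L * p' * q * r = q * p * T * (p' * q * r) := by rw [h.qL]; simp only [mul_assoc]
    _ = q * p * (T * (b * q * b)) * p' * r := by rw [← h.bqb_pr]; simp only [mul_assoc]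

theorem a_L_a_r (h : LocalRel a b q r p p' p'' T L) :
    a * L * a * r = a * b * T * b * a * p' * r := by
  symm
  calc a * b * T * b * a * p' * r = a * b * T * b * (a * p') * r := by simp only [mul_assoc]
    _ = a * b * T * (b * p) * (a * r) := by rw [h.ap]; simp only [mul_assoc]
    _ = a * b * T * p * (b * b) * q * b * a := by rw [h.bp, h.ar]; simp only [mul_assoc]
    _ = a * b * (T * p * q) * b * a := by rw [h.bb, mul_one]; simp only [mul_assoc]
    _ = a * (b * L) * q * b * a := by rw [← h.Lq]; simp only [mul_assoc]
    _ = a * L * (b * q * b * a) := by rw [← h.Lb]; simp only [mul_assoc]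
    _ = a * L * a * r := by rw [← h.ar]; simp only [mul_assoc]

theorem bqb_p_q_p_r (h : LocalRel a b q r p p' p'' T L) :
    b * q * b * p * q * p' * r = a * r := by
  calc b * q * b * p * q * p' * r = a * r * (a * p * q) * p' * r := by
        rw [h.bqb]; simp only [mul_assoc]
    _ = a * r * (p' * q * p') * r := by rw [h.apq]; simp only [mul_assoc]
    _ = a * (r * p' * r) := by rw [h.pqp]; simp only [mul_assoc]
    _ = a * r := by rw [h.rpr]

end Monoid

section Ring

variable {R : Type*} [Ring R] {a b q r p p' p'' T L : R}

theorem next_sigH (h : LocalRel a b q r p p' p'' T L) :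
    a * b * T * b * a + q * L * b * q * b + b * q * L * b * q - q * L * a * r * p' * q
        - b * q * p' * r * a * L * q * b =
      a * b * T * b * a + q * p * (T * (b * q * b)) + b * q * b * T * p * q - q * (b * T * b)
        - b * q * b * T := by
  have h₁ : q * L * b * q * b = q * p * (T * (b * q * b)) := by
    rw [h.qL]; simp only [mul_assoc]
  have h₂ : b * q * L * b * q = b * q * b * T * p * q := by
    calc b * q * L * b * q = b * q * (L * b) * q := by simp only [mul_assoc]
      _ = b * q * b * (L * q) := by rw [h.Lb]; simp only [mul_assoc]
      _ = b * q * b * T * p * q := by rw [h.Lq]; simp only [mul_assoc]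
  have h₃ : b * q * p' * r * a * L * q * b = b * q * b * T := by
    calc b * q * p' * r * a * L * q * b = b * (q * p' * r * a * L * q) * b := by
          simp only [mul_assoc]
      _ = b * q * b * T * (b * b) := by rw [h.q_p_r_a_L_q]; simp only [mul_assoc]
      _ = b * q * b * T := by rw [h.bb, mul_one]
  rw [h₁, h₂, h₃, h.q_L_a_r_p_q]

theorem next_L_mul (h : LocalRel a b q r p p' p'' T L) :
    (-(a * L * q) - q * L * a + q * L * p' * q + a * L * a + T * a) * r =
      (a * b * T * b * a + q * L * b * q * b + b * q * L * b * q - q * L * a * r * p' * q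
        - b * q * p' * r * a * L * q * b) * p' * r := by
  have h₅ : b * q * b * T * p * q * p' * r = T * a * r := by
    calc b * q * b * T * p * q * p' * r = T * (b * q * b * p * q * p' * r) := by
          rw [← h.T_bqb]; simp only [mul_assoc]
      _ = T * a * r := by rw [h.bqb_p_q_p_r, mul_assoc]
  rw [h.next_sigH]
  simp only [add_mul, sub_mul, neg_mul]
  rw [h₅, h.a_L_q_r, h.q_bTb_p_r, h.q_L_p_q_r, h.a_L_a_r]
  abel

theorem mul_next_L (h : LocalRel a b q r p p' p'' T L) :
    r * (-(a * L * q) - q * L * a + q * L * p' * q + a * L * a + T * a) =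
      r * p' * (a * b * T * b * a + q * L * b * q * b + b * q * L * b * q
        - q * L * a * r * p' * q - b * q * p' * r * a * L * q * b) := by
  have h' := congrArg MulOpposite.unop h.op.next_L_mul
  rw [h.op.next_sigH] at h'
  simp only [MulOpposite.unop_mul, MulOpposite.unop_add, MulOpposite.unop_sub,
    MulOpposite.unop_neg, MulOpposite.unop_op, ← mul_assoc] at h'
  rw [h.next_sigH]
  calc _ = r * (-(q * L * a) - a * L * q + q * p' * L * q + a * L * a + a * T) := by
        rw [mul_assoc q p' L, ← h.Lp, ← mul_assoc, h.Ta]; congr 1; abel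
    _ = _ := h'
    _ = _ := by
        have hw : T * b * q * b = b * q * b * T := by simpa only [← mul_assoc] using h.T_bqb
        rw [h.q_comm]
        simp only [← mul_assoc]
        rw [hw]
        congr 1
        abel

theorem next_sigH_mul (h : LocalRel a b q r p p' p'' T L) (aba : a * b * a = b * a * b) :
    (a * b * T * b * a + q * L * b * q * b + b * q * L * b * q - q * L * a * r * p' * q
        - b * q * p' * r * a * L * q * b) * b =
      a * b * (T * a) * b * a + b * q * L * b * q * b + q * L * b * q - b * q * L * a * r * p' * q
        - q * p' * r * a * L * q * b := by
  have e₁ : a * b * T * b * a * b = a * b * (T * a) * b * a := by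
    calc a * b * T * b * a * b = a * b * T * (b * a * b) := by simp only [mul_assoc]
      _ = a * b * (T * a) * b * a := by rw [← aba]; simp only [mul_assoc]
  have e₂ : q * L * a * r * p' * q * b = q * p' * r * a * L * q * b := by
    rw [h.q_L_a_r_p_q, h.q_p_r_a_L_q]
  have e₃ : b * q * p' * r * a * L * q = b * q * L * a * r * p' * q := by
    simpa only [mul_assoc] using
      congrArg (b * ·) (h.q_p_r_a_L_q.trans h.q_L_a_r_p_q.symm)
  simp only [add_mul, sub_mul]
  rw [mul_assoc (q * L * b * q), mul_assoc (b * q * p' * r * a * L * q), h.bb, mul_one, mul_one,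
    e₁, e₂, e₃]
  abel

theorem mul_next_sigH (h : LocalRel a b q r p p' p'' T L) (aba : a * b * a = b * a * b) :
    b * (a * b * T * b * a + q * L * b * q * b + b * q * L * b * q - q * L * a * r * p' * q
        - b * q * p' * r * a * L * q * b) =
      a * b * (T * a) * b * a + b * q * L * b * q * b + q * L * b * q - b * q * L * a * r * p' * q
        - q * p' * r * a * L * q * b := by
  have e₁ : b * (a * b * T * b * a) = a * b * (T * a) * b * a := by
    calc b * (a * b * T * b * a) = b * a * b * T * b * a := by simp only [mul_assoc]
      _ = a * b * (a * T) * b * a := by rw [← aba]; simp only [mul_assoc]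
      _ = a * b * (T * a) * b * a := by rw [h.Ta]
  have e₂ (x : R) : b * (b * x) = x := by rw [← mul_assoc, h.bb, one_mul]
  simp only [mul_add, mul_sub, e₁]
  simp only [mul_assoc, e₂]

theorem commute_next_sigH (h : LocalRel a b q r p p' p'' T L) {c u : R} (ua : Commute u a)
    (up : Commute u p) (up' : Commute u p') (uq : Commute u q) (ur : Commute u r)
    (uL : Commute u L) (uT : Commute u T) (bub : b * u * b = c * r * c) (cT : Commute c T) :
    Commute u (a * b * T * b * a + q * L * b * q * b + b * q * L * b * q
        - q * L * a * r * p' * q - b * q * p' * r * a * L * q * b) := by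
  rw [h.next_sigH, ← h.q_L_a_r_p_q]
  have uw : Commute u (b * q * b) := by
    rw [h.bqb]; exact (ua.mul_right ur).mul_right ua
  have uT' : Commute u (b * T * b) := by
    have rT : Commute r T := h.Tr.symm
    have hT : Commute (b * u * b) T := by
      rw [bub]; exact (cT.mul_left rT).mul_left cT
    calc u * (b * T * b) = b * b * u * (b * T * b) := by rw [h.bb, one_mul]
      _ = b * (b * u * b * T) * b := by simp only [mul_assoc]
      _ = b * T * b * u * (b * b) := by rw [hT.eq]; simp only [mul_assoc]
      _ = b * T * b * u := by rw [h.bb, mul_one]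
  have u1 : Commute u (a * b * T * b * a) := by
    have := (ua.mul_right uT').mul_right ua
    simpa only [mul_assoc] using this
  exact (((u1.add_right ((uq.mul_right up).mul_right (uT.mul_right uw))).add_right
    (((uw.mul_right uT).mul_right up).mul_right uq)).sub_right
    (((((uq.mul_right uL).mul_right ua).mul_right ur).mul_right up').mul_right uq)).sub_right
    (uw.mul_right uT)

end Ring

end LocalRel

namespace PartitionAlgebra

variable {k : ℕ} {A : Type*} [Ring A] [Algebra (Polynomial ℤ) A]

theorem L_add_two (P : PartitionAlgebra k A) (n : ℕ) :
    P.L (n + 2) = -(P.s (n + 1) * P.L (n + 1) * P.q (n + 1))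
      - P.q (n + 1) * P.L (n + 1) * P.s (n + 1)
      + P.q (n + 1) * P.L (n + 1) * P.p (n + 2) * P.q (n + 1)
      + P.s (n + 1) * P.L (n + 1) * P.s (n + 1) + P.sig (n + 2) := by
  rfl

theorem sig_add_three (P : PartitionAlgebra k A) (n : ℕ) :
    P.sig (n + 3) = P.s (n + 1) * P.s (n + 2) * P.sig (n + 2) * P.s (n + 2) * P.s (n + 1)
      + P.s (n + 2) * P.q (n + 1) * P.L (n + 1) * P.s (n + 2) * P.q (n + 1) * P.s (n + 2)
      + P.q (n + 1) * P.L (n + 1) * P.s (n + 2) * P.q (n + 1)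
      - P.s (n + 2) * P.q (n + 1) * P.L (n + 1) * P.s (n + 1) * P.q (n + 2) * P.p (n + 2)
          * P.q (n + 1)
      - P.q (n + 1) * P.p (n + 2) * P.q (n + 2) * P.s (n + 1) * P.L (n + 1) * P.q (n + 1)
          * P.s (n + 2) := by
  rfl

theorem sigH_add_two (P : PartitionAlgebra k A) (n : ℕ) :
    P.sigH (n + 2) = P.s (n + 1) * P.s (n + 2) * P.sigH (n + 1) * P.s (n + 2) * P.s (n + 1)
      + P.q (n + 1) * P.L (n + 1) * P.s (n + 2) * P.q (n + 1) * P.s (n + 2)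
      + P.s (n + 2) * P.q (n + 1) * P.L (n + 1) * P.s (n + 2) * P.q (n + 1)
      - P.q (n + 1) * P.L (n + 1) * P.s (n + 1) * P.q (n + 2) * P.p (n + 2) * P.q (n + 1)
      - P.s (n + 2) * P.q (n + 1) * P.p (n + 2) * P.q (n + 2) * P.s (n + 1)
          * P.L (n + 1) * P.q (n + 1) * P.s (n + 2) := by
  rfl

theorem commute_L_sig (P : PartitionAlgebra k A) {x : A} : ∀ n : ℕ,
    (∀ j, 1 ≤ j → j ≤ n → Commute x (P.p j)) → (∀ j, 1 ≤ j → j < n → Commute x (P.s j)) →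
    (∀ j, 1 ≤ j → j < n → Commute x (P.q j)) → Commute x (P.L n) ∧ Commute x (P.sig n)
  | 0, _, _, _ => ⟨Commute.zero_right x, Commute.one_right x⟩
  | 1, hp, _, _ => ⟨hp 1 le_rfl le_rfl, Commute.one_right x⟩
  | n + 2, hp, hs, hq => by
    have ⟨L₁, S₁⟩ := P.commute_L_sig (n + 1) (fun j h₁ h₂ => hp j h₁ (by lia))
      (fun j h₁ h₂ => hs j h₁ (by lia)) (fun j h₁ h₂ => hq j h₁ (by lia))
    have s₁ := hs (n + 1) (by lia) (by lia)
    have q₁ := hq (n + 1) (by lia) (by lia)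
    have p₂ := hp (n + 2) (by lia) (by lia)
    have key : Commute x (P.sig (n + 2)) := by
      match n with
      | 0 => exact s₁
      | n + 1 =>
        have L₀ := (P.commute_L_sig (n + 1) (fun j h₁ h₂ => hp j h₁ (by lia))
          (fun j h₁ h₂ => hs j h₁ (by lia)) (fun j h₁ h₂ => hq j h₁ (by lia))).1
        have s₀ := hs (n + 1) (by lia) (by lia)
        have q₀ := hq (n + 1) (by lia) (by lia)
        have p₁ := hp (n + 2) (by lia) (by lia)
        rw [sig_add_three]
        repeat' first
          | assumption
          | apply Commute.add_right
          | apply Commute.sub_right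
          | apply Commute.mul_right
    refine ⟨?_, key⟩
    rw [L_add_two]
    repeat' first
      | assumption
      | apply Commute.add_right
      | apply Commute.sub_right
      | apply Commute.neg_right
      | apply Commute.mul_right

theorem commute_sigH (P : PartitionAlgebra k A) {x : A} : ∀ n : ℕ,
    (∀ j, 1 ≤ j → j ≤ n → Commute x (P.p j)) → (∀ j, 1 ≤ j → j ≤ n → Commute x (P.s j)) →
    (∀ j, 1 ≤ j → j ≤ n → Commute x (P.q j)) → Commute x (P.sigH n)
  | 0, _, _, _ => Commute.one_right x
  | 1, _, _, _ => Commute.one_right x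
  | n + 2, hp, hs, hq => by
    have T₁ := P.commute_sigH (n + 1) (fun j h₁ h₂ => hp j h₁ (by lia))
      (fun j h₁ h₂ => hs j h₁ (by lia)) (fun j h₁ h₂ => hq j h₁ (by lia))
    have L₁ := (P.commute_L_sig (n + 1) (fun j h₁ h₂ => hp j h₁ (by lia))
      (fun j h₁ h₂ => hs j h₁ (by lia)) (fun j h₁ h₂ => hq j h₁ (by lia))).1
    have s₁ := hs (n + 1) (by lia) (by lia)
    have q₁ := hq (n + 1) (by lia) (by lia)
    have s₂ := hs (n + 2) (by lia) (by lia)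
    have q₂ := hq (n + 2) (by lia) (by lia)
    have p₂ := hp (n + 2) (by lia) (by lia)
    rw [sigH_add_two]
    repeat' first
      | assumption
      | apply Commute.add_right
      | apply Commute.sub_right
      | apply Commute.mul_right

/-- The element `σ_{n+1/2}` as related to `s_n`, `p_{n+1/2}` and `p_{n+3/2}`. -/
structure SigHRel (P : PartitionAlgebra k A) (n : ℕ) : Prop where
  sigH_s : P.sigH n * P.s n = P.sig (n + 1)
  s_sigH : P.s n * P.sigH n = P.sig (n + 1)
  q_L : P.q n * P.L n = P.q n * P.p n * P.sigH n
  L_q : P.L n * P.q n = P.sigH n * P.p n * P.q n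
  commute_q : n + 1 ≤ k - 1 → Commute (P.q (n + 1)) (P.sigH n)

theorem SigHRel.localRel {P : PartitionAlgebra k A} {n : ℕ} (h : P.SigHRel n) (hn : 1 ≤ n)
    (hnk : n + 1 ≤ k - 1) :
    LocalRel (P.s n) (P.s (n + 1)) (P.q n) (P.q (n + 1)) (P.p n) (P.p (n + 1)) (P.p (n + 2))
      (P.sigH n) (P.L n) where
  aa := P.s_sq n hn (by lia)
  bb := P.s_sq (n + 1) (by lia) hnk
  aq := P.s_q n hn (by lia)
  qa := P.q_s n hn (by lia)
  br := P.s_q (n + 1) (by lia) hnk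
  rb := P.q_s (n + 1) (by lia) hnk
  apa := P.sps n hn (by lia)
  bpb := P.sps (n + 1) (by lia) hnk
  bqb := P.sqs (n + 1) (by lia) hnk
  qr := P.q_comm n (n + 1) hn (by lia) (by lia) hnk
  rpr := P.qpq₁ (n + 1) (by lia) hnk
  qpq := P.qpq₂ n hn (by lia)
  prp := P.pqp₂ (n + 1) (by lia) hnk
  pqp := P.pqp₁ (n + 1) (by lia) (by lia)
  bp := P.s_p (n + 1) n (by lia) hnk hn (by lia) (by lia) (by lia)
  qp := P.q_p n (n + 2) hn (by lia) (by lia) (by lia) (by lia) (by lia)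
  Ta := h.sigH_s.trans h.s_sigH.symm
  Tr := (h.commute_q hnk).eq.symm
  Tp := Commute.symm <| P.commute_sigH n
    (fun j _ _ => P.p_comm (n + 2) j (by lia) (by lia) (by lia) (by lia))
    (fun j _ _ => (P.s_p j (n + 2) (by lia) (by lia) (by lia) (by lia) (by lia) (by lia)).symm)
    (fun j _ _ => (P.q_p j (n + 2) (by lia) (by lia) (by lia) (by lia) (by lia) (by lia)).symm)
  Lb := Commute.symm <| (P.commute_L_sig n
    (fun j _ _ => P.s_p (n + 1) j (by lia) (by lia) (by lia) (by lia) (by lia) (by lia))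
    (fun j _ _ => P.s_comm (n + 1) j (by lia) (by lia) (by lia) (by lia) (by lia) (by lia))
    (fun j _ _ => P.s_q' (n + 1) j (by lia) (by lia) (by lia) (by lia) (by lia) (by lia))).1
  Lp := Commute.symm <| (P.commute_L_sig n
    (fun j _ _ => P.p_comm (n + 1) j (by lia) (by lia) (by lia) (by lia))
    (fun j _ _ => (P.s_p j (n + 1) (by lia) (by lia) (by lia) (by lia) (by lia) (by lia)).symm)
    (fun j _ _ => (P.q_p j (n + 1) (by lia) (by lia) (by lia) (by lia) (by lia) (by lia)).symm)).1
  qL := h.q_L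
  Lq := h.L_q

theorem sigHRel_one (P : PartitionAlgebra k A) : P.SigHRel 1 where
  sigH_s := one_mul (P.s 1)
  s_sigH := mul_one (P.s 1)
  q_L := (mul_one (P.q 1 * P.p 1)).symm
  L_q := congrArg (· * P.q 1) (one_mul (P.p 1)).symm
  commute_q _ := Commute.one_right (P.q 2)

theorem SigHRel.succ {P : PartitionAlgebra k A} {n : ℕ} (h : P.SigHRel (n + 1))
    (hnk : n + 2 ≤ k - 1) : P.SigHRel (n + 2) := by
  have hl := h.localRel (by lia) hnk
  have braid := P.braid (n + 1) (by lia) hnk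
  constructor
  · rw [sig_add_three, sigH_add_two, ← h.sigH_s]
    exact hl.next_sigH_mul braid
  · rw [sig_add_three, sigH_add_two, ← h.sigH_s]
    exact hl.mul_next_sigH braid
  · rw [L_add_two, sigH_add_two, ← h.sigH_s]
    exact hl.mul_next_L
  · rw [L_add_two, sigH_add_two, ← h.sigH_s]
    exact hl.next_L_mul
  · intro hk'
    rw [sigH_add_two]
    refine hl.commute_next_sigH (c := P.s (n + 3))
      (P.s_q' (n + 1) (n + 3) (by lia) (by lia) (by lia) (by lia) (by lia) (by lia)).symm
      (P.q_p (n + 3) (n + 1) (by lia) (by lia) (by lia) (by lia) (by lia) (by lia))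
      (P.q_p (n + 3) (n + 2) (by lia) (by lia) (by lia) (by lia) (by lia) (by lia))
      (P.q_comm (n + 3) (n + 1) (by lia) (by lia) (by lia) (by lia))
      (P.q_comm (n + 3) (n + 2) (by lia) (by lia) (by lia) (by lia))
      (P.commute_L_sig (n + 1) ?_ ?_ ?_).1 (P.commute_sigH (n + 1) ?_ ?_ ?_)
      (P.sqs (n + 3) (by lia) hk').symm (P.commute_sigH (n + 1) ?_ ?_ ?_)
    all_goals intro j _ _
    · exact P.q_p (n + 3) j (by lia) (by lia) (by lia) (by lia) (by lia) (by lia)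
    · exact (P.s_q' j (n + 3) (by lia) (by lia) (by lia) (by lia) (by lia) (by lia)).symm
    · exact P.q_comm (n + 3) j (by lia) (by lia) (by lia) (by lia)
    · exact P.q_p (n + 3) j (by lia) (by lia) (by lia) (by lia) (by lia) (by lia)
    · exact (P.s_q' j (n + 3) (by lia) (by lia) (by lia) (by lia) (by lia) (by lia)).symm
    · exact P.q_comm (n + 3) j (by lia) (by lia) (by lia) (by lia)
    · exact P.s_p (n + 3) j (by lia) (by lia) (by lia) (by lia) (by lia) (by lia)
    · exact P.s_comm (n + 3) j (by lia) (by lia) (by lia) (by lia) (by lia) (by lia)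
    · exact P.s_q' (n + 3) j (by lia) (by lia) (by lia) (by lia) (by lia) (by lia)

theorem sigHRel (P : PartitionAlgebra k A) : ∀ n, n + 1 ≤ k - 1 → P.SigHRel (n + 1)
  | 0, _ => P.sigHRel_one
  | n + 1, hn => (P.sigHRel n (by lia)).succ hn

end PartitionAlgebra

/-- Proposition 3.4: `σ_{i+1/2} s_i = s_i σ_{i+1/2} = σ_{i+1}` for `1 ≤ i ≤ k-1`. -/
theorem partitionAlgebra_sigH_s {k : ℕ} (hk : 2 ≤ k) {A : Type*} [Ring A]
    [Algebra (Polynomial ℤ) A] (P : PartitionAlgebra k A) :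
    ∀ i, 1 ≤ i → i ≤ k - 1 →
      P.sigH i * P.s i = P.sig (i + 1) ∧ P.s i * P.sigH i = P.sig (i + 1) := by
  rintro (_ | n) hi hik
  · contradiction
  · exact ⟨(P.sigHRel n hik).sigH_s, (P.sigHRel n hik).s_sigH⟩
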